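/- Let λ, μ, ν be Borel probability measures on ℝ with λ = μ ▷ ν (monotone convolution, i.e., F_λ = F_μ ∘ F_ν on ℂ⁺), and suppose λ has finite variance. Then μ and ν have finite variances, and m₁(λ) = m₁(μ) + m₁(ν) and σ²(λ) = σ²(μ) + σ²(ν), where m₁ denotes the mean and σ² the variance. -/

import Mathlib

open MeasureTheory Complex ProbabilityTheory

/-- The reciprocal Cauchy transform (`F`-transform) of a measure on `ℝ`. -/
noncomputable def Ftrans (μ : MeasureTheory.Measure ℝ) (z : ℂ) : ℂ :=
  (∫ x : ℝ, (z - (x : ℂ))⁻¹ ∂μ)⁻¹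

/-- The double-integral form of the variance of a complex-valued function. -/
lemma integral_prod_normSq_sub {α : Type*} [MeasurableSpace α] (ρ : Measure α)
    [IsProbabilityMeasure ρ] {f : α → ℂ} (hf : Integrable f ρ)
    (hf2 : Integrable (fun x => normSq (f x)) ρ) :
    Integrable (fun p : α × α => normSq (f p.1 - f p.2)) (ρ.prod ρ) ∧
    ∫ p : α × α, normSq (f p.1 - f p.2) ∂(ρ.prod ρ)
      = 2 * ∫ x, normSq (f x) ∂ρ - 2 * normSq (∫ x, f x ∂ρ) := by
  have hconj : Integrable (fun x => (starRingEnd ℂ) (f x)) ρ :=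
    (conjCLE.toContinuousLinearMap.integrable_comp hf)
  have h1 : Integrable (fun p : α × α => normSq (f p.1)) (ρ.prod ρ) := hf2.comp_fst ρ
  have h2 : Integrable (fun p : α × α => normSq (f p.2)) (ρ.prod ρ) := hf2.comp_snd ρ
  have h3 : Integrable (fun p : α × α => f p.1 * (starRingEnd ℂ) (f p.2)) (ρ.prod ρ) :=
    hf.mul_prod hconj
  have h3' : Integrable (fun p : α × α => (f p.1 * (starRingEnd ℂ) (f p.2)).re) (ρ.prod ρ) :=
    h3.re
  have heq : (fun p : α × α => normSq (f p.1 - f p.2)) = fun p =>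
      normSq (f p.1) + normSq (f p.2) - 2 * (f p.1 * (starRingEnd ℂ) (f p.2)).re := by
    funext p
    exact normSq_sub _ _
  have h4 : ∫ p : α × α, (f p.1 * (starRingEnd ℂ) (f p.2)).re ∂(ρ.prod ρ)
      = normSq (∫ x, f x ∂ρ) := by
    have h5 := integral_re h3
    have h6 := integral_prod_mul (μ := ρ) (ν := ρ) f (fun x => (starRingEnd ℂ) (f x))
    rw [integral_conj, mul_conj] at h6
    rw [h6] at h5
    simpa using h5
  refine ⟨heq ▸ (h1.add h2).sub (h3'.const_mul 2), ?_⟩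
  have h6 := integral_sub (h1.add h2) (h3'.const_mul 2)
  simp only [Pi.add_apply] at h6
  rw [heq, h6, integral_add h1 h2, integral_const_mul, h4, integral_fun_fst (fun x => normSq (f x)),
    integral_fun_snd (fun x => normSq (f x))]
  simp
  ring

lemma sub_ofReal_ne_zero_of_im_pos {w : ℂ} (hw : 0 < w.im) (x : ℝ) : w - x ≠ 0 := by
  intro h
  have := congrArg Complex.im h
  simp at this
  exact hw.ne' this

lemma norm_inv_sub_ofReal_le {w : ℂ} (hw : 0 < w.im) (x : ℝ) :
    ‖(w - (x : ℂ))⁻¹‖ ≤ w.im⁻¹ := by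
  rw [norm_inv]
  have h := abs_im_le_norm (w - (x : ℂ))
  simp only [sub_im, ofReal_im, sub_zero, abs_of_pos hw] at h
  exact inv_anti₀ hw h

lemma measurable_inv_sub_ofReal (w : ℂ) : Measurable (fun x : ℝ => (w - (x : ℂ))⁻¹) := by
  fun_prop

lemma integrable_inv_sub_ofReal (ρ : Measure ℝ) [IsFiniteMeasure ρ] {w : ℂ} (hw : 0 < w.im) :
    Integrable (fun x : ℝ => (w - (x : ℂ))⁻¹) ρ :=
  .of_bound (measurable_inv_sub_ofReal w).aestronglyMeasurable _
    (.of_forall (norm_inv_sub_ofReal_le hw))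

lemma normSq_inv_sub_ofReal_le {w : ℂ} (hw : 0 < w.im) (x : ℝ) :
    normSq (w - (x : ℂ))⁻¹ ≤ (w.im ^ 2)⁻¹ := by
  rw [normSq_eq_norm_sq, ← inv_pow]
  gcongr
  exact norm_inv_sub_ofReal_le hw x

lemma integrable_normSq_inv_sub_ofReal (ρ : Measure ℝ) [IsFiniteMeasure ρ] {w : ℂ}
    (hw : 0 < w.im) : Integrable (fun x : ℝ => normSq (w - (x : ℂ))⁻¹) ρ := by
  refine .of_bound (C := (w.im ^ 2)⁻¹) (Measurable.aestronglyMeasurable ?_) (.of_forall fun x => ?_)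
  · exact continuous_normSq.measurable.comp (measurable_inv_sub_ofReal w)
  · rw [Real.norm_of_nonneg (normSq_nonneg _)]
    exact normSq_inv_sub_ofReal_le hw x

lemma im_integral_inv_sub_ofReal (ρ : Measure ℝ) [IsFiniteMeasure ρ] {w : ℂ} (hw : 0 < w.im) :
    (∫ x : ℝ, (w - (x : ℂ))⁻¹ ∂ρ).im = -(w.im * ∫ x : ℝ, normSq (w - (x : ℂ))⁻¹ ∂ρ) := by
  have h := integral_im (integrable_inv_sub_ofReal ρ hw)
  simp only [RCLike.im_to_complex] at h
  rw [← h, ← integral_const_mul, ← integral_neg]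
  congr 1
  funext x
  rw [inv_im, map_inv₀]
  simp [div_eq_mul_inv]

lemma integral_inv_sub_ofReal_ne_zero (ρ : Measure ℝ) [IsProbabilityMeasure ρ] {w : ℂ}
    (hw : 0 < w.im) : (∫ x : ℝ, (w - (x : ℂ))⁻¹ ∂ρ) ≠ 0 := by
  have hpos : 0 < ∫ x : ℝ, normSq (w - (x : ℂ))⁻¹ ∂ρ := by
    rw [integral_pos_iff_support_of_nonneg (fun x => normSq_nonneg _)
      (integrable_normSq_inv_sub_ofReal ρ hw)]
    have : Function.support (fun x : ℝ => normSq (w - (x : ℂ))⁻¹) = Set.univ := by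
      ext x
      simpa using sub_ofReal_ne_zero_of_im_pos hw x
    rw [this]
    simp
  intro h
  have h2 := im_integral_inv_sub_ofReal ρ hw
  rw [h] at h2
  have := mul_pos hw hpos
  simp only [zero_im] at h2
  linarith

lemma Ftrans_im_sub_im (ρ : Measure ℝ) [IsProbabilityMeasure ρ] {w : ℂ} (hw : 0 < w.im) :
    (Ftrans ρ w).im - w.im = w.im *
      (∫ p : ℝ × ℝ, normSq ((w - (p.1 : ℂ))⁻¹ - (w - (p.2 : ℂ))⁻¹) ∂(ρ.prod ρ)) /
        (2 * normSq (∫ x : ℝ, (w - (x : ℂ))⁻¹ ∂ρ)) := by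
  have hG := integral_inv_sub_ofReal_ne_zero ρ hw
  rw [(integral_prod_normSq_sub ρ (integrable_inv_sub_ofReal ρ hw)
    (integrable_normSq_inv_sub_ofReal ρ hw)).2, Ftrans, inv_im, im_integral_inv_sub_ofReal ρ hw]
  have hpos := normSq_pos.2 hG
  generalize ∫ x : ℝ, (w - (x : ℂ))⁻¹ ∂ρ = G at *
  generalize ∫ x : ℝ, normSq (w - (x : ℂ))⁻¹ ∂ρ = A
  field_simp

lemma im_le_Ftrans_im (ρ : Measure ℝ) [IsProbabilityMeasure ρ] {w : ℂ} (hw : 0 < w.im) :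
    w.im ≤ (Ftrans ρ w).im := by
  rw [← sub_nonneg, Ftrans_im_sub_im ρ hw]
  have h1 := integral_nonneg (μ := ρ.prod ρ)
    (f := fun p : ℝ × ℝ => normSq ((w - (p.1 : ℂ))⁻¹ - (w - (p.2 : ℂ))⁻¹))
    (fun p => normSq_nonneg _)
  have h2 := normSq_nonneg (∫ x : ℝ, (w - (x : ℂ))⁻¹ ∂ρ)
  positivity

section Asymptotics

open Filter Topology

lemma tendsto_mul_inv_sub_ofReal {r : ℕ → ℝ} {w : ℕ → ℂ} (hr0 : ∀ n, 0 < r n)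
    (hr : Tendsto r atTop atTop) (hlim : Tendsto (fun n => w n / r n) atTop (𝓝 I)) (x : ℝ) :
    Tendsto (fun n => (r n : ℂ) * (w n - (x : ℂ))⁻¹) atTop (𝓝 (-I)) := by
  have h1 : Tendsto (fun n => ((x / r n : ℝ) : ℂ)) atTop (𝓝 ((0 : ℝ) : ℂ)) :=
    (continuous_ofReal.tendsto _).comp (hr.const_div_atTop x)
  have h2 := (hlim.sub h1).inv₀ (by simp)
  have h3 : (I - ((0 : ℝ) : ℂ))⁻¹ = -I := by simp
  rw [h3] at h2
  refine h2.congr fun n => ?_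
  have : (r n : ℂ) ≠ 0 := ofReal_ne_zero.2 (hr0 n).ne'
  rw [ofReal_div, ← sub_div, inv_div, div_eq_mul_inv]

lemma norm_mul_inv_sub_ofReal_le {r : ℝ} {w : ℂ} (hr : 0 < r) (hrw : r ≤ w.im) (x : ℝ) :
    ‖(r : ℂ) * (w - (x : ℂ))⁻¹‖ ≤ 1 := by
  rw [norm_mul, norm_real, Real.norm_of_nonneg hr.le]
  calc r * ‖(w - (x : ℂ))⁻¹‖ ≤ r * r⁻¹ := by
        gcongr
        exact (norm_inv_sub_ofReal_le (hr.trans_le hrw) x).trans (inv_anti₀ hr hrw)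
    _ = 1 := mul_inv_cancel₀ hr.ne'

lemma tendsto_mul_integral_inv_sub_ofReal (ρ : Measure ℝ) [IsProbabilityMeasure ρ]
    {r : ℕ → ℝ} {w : ℕ → ℂ} (hr0 : ∀ n, 0 < r n) (hr : Tendsto r atTop atTop)
    (hrw : ∀ n, r n ≤ (w n).im) (hlim : Tendsto (fun n => w n / r n) atTop (𝓝 I)) :
    Tendsto (fun n => (r n : ℂ) * ∫ x : ℝ, (w n - (x : ℂ))⁻¹ ∂ρ) atTop (𝓝 (-I)) := by
  have h := tendsto_integral_of_dominated_convergence (μ := ρ) (f := fun _ => -I)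
    (F := fun n (x : ℝ) => (r n : ℂ) * (w n - (x : ℂ))⁻¹) (fun _ => 1)
    (fun n => ((measurable_inv_sub_ofReal (w n)).const_mul _).aestronglyMeasurable)
    (integrable_const _)
    (fun n => .of_forall (norm_mul_inv_sub_ofReal_le (hr0 n) (hrw n)))
    (.of_forall (tendsto_mul_inv_sub_ofReal hr0 hr hlim))
  simpa [integral_const_mul] using h

lemma pow_four_mul_normSq_inv_sub_inv {w : ℂ} (hw : 0 < w.im) (r x y : ℝ) :
    r ^ 4 * normSq ((w - (x : ℂ))⁻¹ - (w - (y : ℂ))⁻¹) =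
      (x - y) ^ 2 * (normSq ((r : ℂ) * (w - (x : ℂ))⁻¹) * normSq ((r : ℂ) * (w - (y : ℂ))⁻¹)) := by
  rw [inv_sub_inv (sub_ofReal_ne_zero_of_im_pos hw x) (sub_ofReal_ne_zero_of_im_pos hw y)]
  have : w - (y : ℂ) - (w - x) = ((x - y : ℝ) : ℂ) := by push_cast; ring
  rw [this]
  simp only [map_mul, map_div₀, normSq_ofReal, map_inv₀]
  field_simp

lemma tendsto_pow_four_mul_normSq {r : ℕ → ℝ} {w : ℕ → ℂ} (hr0 : ∀ n, 0 < r n)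
    (hr : Tendsto r atTop atTop) (hrw : ∀ n, r n ≤ (w n).im)
    (hlim : Tendsto (fun n => w n / r n) atTop (𝓝 I)) (p : ℝ × ℝ) :
    Tendsto (fun n => r n ^ 4 * normSq ((w n - (p.1 : ℂ))⁻¹ - (w n - (p.2 : ℂ))⁻¹)) atTop
      (𝓝 ((p.1 - p.2) ^ 2)) := by
  have h (x : ℝ) := (continuous_normSq.tendsto _).comp (tendsto_mul_inv_sub_ofReal hr0 hr hlim x)
  have h2 := ((h p.1).mul (h p.2)).const_mul ((p.1 - p.2) ^ 2)
  simp only [normSq_neg, normSq_I, mul_one] at h2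
  exact h2.congr fun n =>
    (pow_four_mul_normSq_inv_sub_inv ((hr0 n).trans_le (hrw n)) (r n) p.1 p.2).symm

lemma pow_four_mul_normSq_le {r : ℝ} {w : ℂ} (hr : 0 < r) (hrw : r ≤ w.im) (x y : ℝ) :
    r ^ 4 * normSq ((w - (x : ℂ))⁻¹ - (w - (y : ℂ))⁻¹) ≤ (x - y) ^ 2 := by
  have h (t : ℝ) : normSq ((r : ℂ) * (w - (t : ℂ))⁻¹) ≤ 1 := by
    rw [normSq_eq_norm_sq]
    exact pow_le_one₀ (norm_nonneg _) (norm_mul_inv_sub_ofReal_le hr hrw t)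
  rw [pow_four_mul_normSq_inv_sub_inv (hr.trans_le hrw)]
  exact mul_le_of_le_one_right (sq_nonneg _) (mul_le_one₀ (h x) (normSq_nonneg _) (h y))

lemma mul_Ftrans_im_sub_im (ρ : Measure ℝ) [IsProbabilityMeasure ρ] {r : ℝ} {w : ℂ}
    (hr : 0 < r) (hrw : r ≤ w.im) :
    r * ((Ftrans ρ w).im - w.im) = w.im / r *
      (∫ p : ℝ × ℝ, r ^ 4 * normSq ((w - (p.1 : ℂ))⁻¹ - (w - (p.2 : ℂ))⁻¹) ∂(ρ.prod ρ)) /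
        (2 * normSq ((r : ℂ) * ∫ x : ℝ, (w - (x : ℂ))⁻¹ ∂ρ)) := by
  have hw := hr.trans_le hrw
  rw [Ftrans_im_sub_im ρ hw, integral_const_mul, map_mul, normSq_ofReal]
  have := normSq_pos.2 (integral_inv_sub_ofReal_ne_zero ρ hw)
  field_simp

/-- A probability measure has a finite second moment as soon as the excess
`Im F(w) - Im w` is `O(1 / r)` along a sequence `w ∼ i r` with `r → ∞`. -/
lemma integrable_sq_of_Ftrans_le (ρ : Measure ℝ) [IsProbabilityMeasure ρ]
    {r : ℕ → ℝ} {w : ℕ → ℂ} (hr0 : ∀ n, 0 < r n) (hr : Tendsto r atTop atTop)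
    (hrw : ∀ n, r n ≤ (w n).im) (hlim : Tendsto (fun n => w n / r n) atTop (𝓝 I))
    {C : ℝ} (hC : ∀ n, r n * ((Ftrans ρ (w n)).im - (w n).im) ≤ C) :
    Integrable (fun x : ℝ => x ^ 2) ρ := by
  set K : ℕ → ℝ × ℝ → ℝ := fun n p =>
    r n ^ 4 * normSq ((w n - (p.1 : ℂ))⁻¹ - (w n - (p.2 : ℂ))⁻¹) with hK
  have hw n : 0 < (w n).im := (hr0 n).trans_le (hrw n)
  have hK0 n p : 0 ≤ K n p := mul_nonneg (pow_nonneg (hr0 n).le 4) (normSq_nonneg _)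
  have hKi n : Integrable (K n) (ρ.prod ρ) :=
    (integral_prod_normSq_sub ρ (integrable_inv_sub_ofReal ρ (hw n))
      (integrable_normSq_inv_sub_ofReal ρ (hw n))).1.const_mul _
  have hKle n : ∫ p, K n p ∂(ρ.prod ρ) ≤ 2 * C := by
    have h1 := hC n
    rw [mul_Ftrans_im_sub_im ρ (hr0 n) (hrw n)] at h1
    have hG : normSq ((r n : ℂ) * ∫ x : ℝ, (w n - (x : ℂ))⁻¹ ∂ρ) ≤ 1 := by
      rw [normSq_eq_norm_sq, ← integral_const_mul]
      refine pow_le_one₀ (norm_nonneg _) ?_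
      simpa using norm_integral_le_of_norm_le_const (μ := ρ)
        (.of_forall (norm_mul_inv_sub_ofReal_le (hr0 n) (hrw n)))
    have hG0 : 0 < normSq ((r n : ℂ) * ∫ x : ℝ, (w n - (x : ℂ))⁻¹ ∂ρ) :=
      normSq_pos.2 (mul_ne_zero (ofReal_ne_zero.2 (hr0 n).ne')
        (integral_inv_sub_ofReal_ne_zero ρ (hw n)))
    have hI : 0 ≤ ∫ p, K n p ∂(ρ.prod ρ) := integral_nonneg (hK0 n)
    have h2 : (∫ p, K n p ∂(ρ.prod ρ)) / 2 ≤ C := by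
      refine le_trans ?_ h1
      rw [div_le_div_iff₀ (by norm_num) (by positivity)]
      have h3 : 1 ≤ (w n).im / r n := (one_le_div (hr0 n)).2 (hrw n)
      calc _ ≤ (∫ p, K n p ∂(ρ.prod ρ)) * (2 * 1) := by gcongr
        _ = 1 * (∫ p, K n p ∂(ρ.prod ρ)) * 2 := by ring
        _ ≤ _ := by gcongr
    linarith
  have hfin : ∫⁻ p : ℝ × ℝ, ENNReal.ofReal ((p.1 - p.2) ^ 2) ∂(ρ.prod ρ)
      ≤ ENNReal.ofReal (2 * C) := by
    calc _ = ∫⁻ p : ℝ × ℝ, liminf (fun n => ENNReal.ofReal (K n p)) atTop ∂(ρ.prod ρ) := by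
          congr 1
          funext p
          exact ((ENNReal.continuous_ofReal.tendsto _).comp
            (tendsto_pow_four_mul_normSq hr0 hr hrw hlim p)).liminf_eq.symm
      _ ≤ liminf (fun n => ∫⁻ p : ℝ × ℝ, ENNReal.ofReal (K n p) ∂(ρ.prod ρ)) atTop :=
          lintegral_liminf_le' fun n => (hKi n).aemeasurable.ennreal_ofReal
      _ ≤ liminf (fun _ : ℕ => ENNReal.ofReal (2 * C)) atTop := by
          refine liminf_le_liminf (.of_forall fun n => ?_)
          rw [← ofReal_integral_eq_lintegral_ofReal (hKi n) (.of_forall (hK0 n))]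
          exact ENNReal.ofReal_le_ofReal (hKle n)
      _ = _ := liminf_const _
  have hInt : Integrable (fun p : ℝ × ℝ => (p.1 - p.2) ^ 2) (ρ.prod ρ) := by
    refine ⟨by fun_prop, ?_⟩
    rw [hasFiniteIntegral_iff_ofReal (.of_forall fun p => sq_nonneg _)]
    exact hfin.trans_lt ENNReal.ofReal_lt_top
  obtain ⟨y, hy⟩ := hInt.prod_left_ae.exists
  have h2 : MemLp (fun x : ℝ => x - y) 2 ρ := (memLp_two_iff_integrable_sq (by fun_prop)).2 hy
  simpa using (h2.add (memLp_const y)).integrable_sq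

lemma tendsto_mul_Ftrans_im_sub_im (ρ : Measure ℝ) [IsProbabilityMeasure ρ]
    {r : ℕ → ℝ} {w : ℕ → ℂ} (hr0 : ∀ n, 0 < r n) (hr : Tendsto r atTop atTop)
    (hrw : ∀ n, r n ≤ (w n).im) (hlim : Tendsto (fun n => w n / r n) atTop (𝓝 I))
    (hρ : Integrable (fun x : ℝ => x ^ 2) ρ) :
    Tendsto (fun n => r n * ((Ftrans ρ (w n)).im - (w n).im)) atTop (𝓝 (variance id ρ)) := by
  have hmem : MemLp (id : ℝ → ℝ) 2 ρ := (memLp_two_iff_integrable_sq (by fun_prop)).2 hρ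
  have hid : Integrable (fun x : ℝ => (x : ℂ)) ρ := (hmem.integrable (by norm_num)).ofReal
  have hsq : Integrable (fun x : ℝ => normSq (x : ℂ)) ρ := by
    simpa only [normSq_ofReal, ← pow_two] using hρ
  have hprod := integral_prod_normSq_sub ρ hid hsq
  simp only [← ofReal_sub, normSq_ofReal, ← pow_two] at hprod
  have hvar : ∫ p : ℝ × ℝ, (p.1 - p.2) ^ 2 ∂(ρ.prod ρ) = 2 * variance id ρ := by
    rw [hprod.2, variance_eq_sub hmem, integral_complex_ofReal, normSq_ofReal]
    simp only [Pi.pow_apply, id_eq]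
    ring
  have hw n : 0 < (w n).im := (hr0 n).trans_le (hrw n)
  have hK := tendsto_integral_of_dominated_convergence (μ := ρ.prod ρ)
    (F := fun n (p : ℝ × ℝ) => r n ^ 4 * normSq ((w n - (p.1 : ℂ))⁻¹ - (w n - (p.2 : ℂ))⁻¹))
    (fun p : ℝ × ℝ => (p.1 - p.2) ^ 2)
    (fun n => ((integral_prod_normSq_sub ρ (integrable_inv_sub_ofReal ρ (hw n))
      (integrable_normSq_inv_sub_ofReal ρ (hw n))).1.const_mul _).aestronglyMeasurable)
    hprod.1
    (fun n => .of_forall fun p => by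
      rw [Real.norm_of_nonneg (mul_nonneg (pow_nonneg (hr0 n).le 4) (normSq_nonneg _))]
      exact pow_four_mul_normSq_le (hr0 n) (hrw n) p.1 p.2)
    (.of_forall (tendsto_pow_four_mul_normSq hr0 hr hrw hlim))
  have hG := (continuous_normSq.tendsto _).comp
    (tendsto_mul_integral_inv_sub_ofReal ρ hr0 hr hrw hlim)
  have him := (continuous_im.tendsto _).comp hlim
  have h := (him.mul hK).div (hG.const_mul 2) (by simp)
  have heq : I.im * (∫ p : ℝ × ℝ, (p.1 - p.2) ^ 2 ∂(ρ.prod ρ)) / (2 * normSq (-I))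
      = variance id ρ := by
    rw [hvar]
    simp
  rw [heq] at h
  refine h.congr fun n => ?_
  rw [mul_Ftrans_im_sub_im ρ (hr0 n) (hrw n)]
  simp [div_ofReal_im]

lemma tendsto_Ftrans_sub (ρ : Measure ℝ) [IsProbabilityMeasure ρ]
    {r : ℕ → ℝ} {w : ℕ → ℂ} (hr0 : ∀ n, 0 < r n) (hr : Tendsto r atTop atTop)
    (hrw : ∀ n, r n ≤ (w n).im) (hlim : Tendsto (fun n => w n / r n) atTop (𝓝 I))
    (hρ : Integrable (fun x : ℝ => x) ρ) :
    Tendsto (fun n => Ftrans ρ (w n) - w n) atTop (𝓝 (-((∫ x : ℝ, x ∂ρ : ℝ) : ℂ))) := by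
  have hw n : 0 < (w n).im := (hr0 n).trans_le (hrw n)
  have hG := tendsto_mul_integral_inv_sub_ofReal ρ hr0 hr hrw hlim
  have hX := tendsto_integral_of_dominated_convergence (μ := ρ)
    (F := fun n (x : ℝ) => (x : ℂ) * ((r n : ℂ) * (w n - (x : ℂ))⁻¹))
    (f := fun x => (x : ℂ) * -I) (fun x => ‖x‖)
    (fun n => Measurable.aestronglyMeasurable (by fun_prop))
    hρ.norm
    (fun n => .of_forall fun x => by
      rw [norm_mul, norm_real]
      exact mul_le_of_le_one_right (norm_nonneg _) (norm_mul_inv_sub_ofReal_le (hr0 n) (hrw n) x))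
    (.of_forall fun x => (tendsto_mul_inv_sub_ofReal hr0 hr hlim x).const_mul _)
  have h := (hX.div hG (by simp)).neg
  have heq : (∫ x : ℝ, (x : ℂ) * -I ∂ρ) / -I = ((∫ x : ℝ, x ∂ρ : ℝ) : ℂ) := by
    rw [integral_mul_const, integral_complex_ofReal, mul_div_cancel_right₀ _ (by simp)]
  rw [heq] at h
  refine h.congr fun n => ?_
  have hne := integral_inv_sub_ofReal_ne_zero ρ (hw n)
  have hrn : (r n : ℂ) ≠ 0 := ofReal_ne_zero.2 (hr0 n).ne'
  have hInt : ∫ x : ℝ, (x : ℂ) * ((r n : ℂ) * (w n - (x : ℂ))⁻¹) ∂ρ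
      = r n * (w n * (∫ x : ℝ, (w n - (x : ℂ))⁻¹ ∂ρ) - 1) := by
    have h1 : ∀ x : ℝ, (x : ℂ) * ((r n : ℂ) * (w n - (x : ℂ))⁻¹)
        = r n * (w n * (w n - (x : ℂ))⁻¹ - 1) := fun x => by
      have := sub_ofReal_ne_zero_of_im_pos (hw n) x
      field_simp
      ring
    simp_rw [h1]
    rw [integral_const_mul, integral_sub ((integrable_inv_sub_ofReal ρ (hw n)).const_mul _)
      (integrable_const _), integral_const_mul]
    simp
  simp only [Pi.div_apply, hInt, Ftrans]
  generalize ∫ x : ℝ, (w n - (x : ℂ))⁻¹ ∂ρ = G at *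
  field_simp
  ring

end Asymptotics


/-- If `λ = μ ▷ ν` (monotone convolution, i.e. `F_λ = F_μ ∘ F_ν` on the upper
half-plane) and `λ` has finite variance, then `μ` and `ν` have finite variances,
and both the means and the variances are additive. -/
theorem monotone_convolution_variance (lam μ ν : Measure ℝ)
    [IsProbabilityMeasure lam] [IsProbabilityMeasure μ] [IsProbabilityMeasure ν]
    (hconv : ∀ z : ℂ, 0 < z.im → Ftrans lam z = Ftrans μ (Ftrans ν z))
    (hvar : Integrable (fun x : ℝ => x ^ 2) lam) :
    Integrable (fun x : ℝ => x ^ 2) μ ∧ Integrable (fun x : ℝ => x ^ 2) ν ∧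
    (∫ x : ℝ, x ∂lam) = (∫ x : ℝ, x ∂μ) + (∫ x : ℝ, x ∂ν) ∧
    variance id lam = variance id μ + variance id ν := by
  let r : ℕ → ℝ := fun n => n + 1
  have hr0 n : 0 < r n := by positivity
  have hr : Filter.Tendsto r Filter.atTop Filter.atTop :=
    Filter.tendsto_atTop_add_const_right _ _ tendsto_natCast_atTop_atTop
  let z : ℕ → ℂ := fun n => r n * I
  have hzim n : (z n).im = r n := by simp [z]
  have hz n : 0 < (z n).im := by rw [hzim]; exact hr0 n
  have hrz n : r n ≤ (z n).im := (hzim n).ge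
  have hzlim : Filter.Tendsto (fun n => z n / r n) Filter.atTop (nhds I) := by
    refine tendsto_const_nhds.congr fun n => ?_
    exact (mul_div_cancel_left₀ I (ofReal_ne_zero.2 (hr0 n).ne')).symm
  let w : ℕ → ℂ := fun n => Ftrans ν (z n)
  have hzw n : (z n).im ≤ (w n).im := im_le_Ftrans_im ν (hz n)
  have hrw n : r n ≤ (w n).im := (hrz n).trans (hzw n)
  have hw n : 0 < (w n).im := (hz n).trans_le (hzw n)
  have hwμ n : (w n).im ≤ (Ftrans μ (w n)).im := im_le_Ftrans_im μ (hw n)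
  have hmean {ρ : Measure ℝ} [IsProbabilityMeasure ρ]
      (h : Integrable (fun x : ℝ => x ^ 2) ρ) : Integrable (fun x : ℝ => x) ρ :=
    ((memLp_two_iff_integrable_sq (f := fun x : ℝ => x) (by fun_prop)).2 h).integrable
      (by norm_num)
  have hlam := tendsto_mul_Ftrans_im_sub_im lam hr0 hr hrz hzlim hvar
  obtain ⟨C, hC⟩ := hlam.bddAbove_range
  have hC n : r n * ((Ftrans μ (w n)).im - (z n).im) ≤ C := by
    rw [← hconv _ (hz n)]
    exact hC ⟨n, rfl⟩
  have hν : Integrable (fun x : ℝ => x ^ 2) ν :=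
    integrable_sq_of_Ftrans_le ν hr0 hr hrz hzlim fun n =>
      (mul_le_mul_of_nonneg_left (sub_le_sub_right (hwμ n) _) (hr0 n).le).trans (hC n)
  have hνF := tendsto_Ftrans_sub ν hr0 hr hrz hzlim (hmean hν)
  have hwlim : Filter.Tendsto (fun n => w n / r n) Filter.atTop (nhds I) := by
    have h1 : Filter.Tendsto (fun n => ((r n)⁻¹ : ℂ)) Filter.atTop (nhds 0) := by
      simpa [Function.comp_def] using (continuous_ofReal.tendsto _).comp hr.inv_tendsto_atTop
    have h2 := hzlim.add (hνF.mul h1)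
    rw [mul_zero, add_zero] at h2
    refine h2.congr fun n => ?_
    rw [← div_eq_mul_inv, ← add_div, add_sub_cancel]
  have hμ : Integrable (fun x : ℝ => x ^ 2) μ :=
    integrable_sq_of_Ftrans_le μ hr0 hr hrw hwlim fun n =>
      (mul_le_mul_of_nonneg_left (sub_le_sub_left (hzw n) _) (hr0 n).le).trans (hC n)
  refine ⟨hμ, hν, ?_, ?_⟩
  · have h1 := (tendsto_Ftrans_sub μ hr0 hr hrw hwlim (hmean hμ)).add hνF
    have h2 := tendsto_nhds_unique
      ((tendsto_Ftrans_sub lam hr0 hr hrz hzlim (hmean hvar)).congr fun n => by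
        rw [hconv _ (hz n), ← sub_add_sub_cancel _ (w n)]) h1
    rw [← neg_add, neg_inj] at h2
    exact_mod_cast h2
  · have h1 := (tendsto_mul_Ftrans_im_sub_im μ hr0 hr hrw hwlim hμ).add
      (tendsto_mul_Ftrans_im_sub_im ν hr0 hr hrz hzlim hν)
    refine tendsto_nhds_unique (hlam.congr fun n => ?_) h1
    rw [hconv _ (hz n), ← mul_add, sub_add_sub_cancel]
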